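/- arXiv:2210.10703 — 7 statements merged into one kernel-verified Lean document; each statement's English description precedes it below -/
import Mathlib

section
/- Proposition 1 (single removal): Assume n⁺ ≥ 2 and n⁻ ≥ 1, and let i be a positive instance (y(i) = 1) such that r'(i)/n ≤ AUC · p⁻. Then the empirical AUC of the reduced sample obtained by removing i is strictly greater than the empirical AUC of the full sample. -/
open Finset

variable {ι : Type*}

/-- The set of positive instances (label 1) in the sample `S`. -/
noncomputable def posSet (S : Finset ι) (y : ι → Bool) : Finset ι :=
  S.filter (fun i => y i = true)

/-- The set of negative instances (label 0) in the sample `S`. -/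
noncomputable def negSet (S : Finset ι) (y : ι → Bool) : Finset ι :=
  S.filter (fun i => y i = false)

/-- The Mann–Whitney count: number of (positive, negative) pairs ranked correctly. -/
noncomputable def mwCount (S : Finset ι) (s : ι → ℝ) (y : ι → Bool) : ℕ :=
  ((S ×ˢ S).filter (fun p => y p.1 = true ∧ y p.2 = false ∧ s p.2 < s p.1)).card

/-- The empirical AUC (Mann–Whitney statistic) of the sample `S`. -/
noncomputable def auc (S : Finset ι) (s : ι → ℝ) (y : ι → Bool) : ℝ :=
  (mwCount S s y : ℝ) / (((posSet S y).card : ℝ) * ((negSet S y).card : ℝ))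

/-- The rank of `i` in non-descending score order: `#{j ∈ S : s j ≤ s i}`. -/
noncomputable def rank' (S : Finset ι) (s : ι → ℝ) (i : ι) : ℕ :=
  (S.filter (fun j => s j ≤ s i)).card

/-- `t(i)`: the number of positive instances with score at least `s i`. -/
noncomputable def tcount (S : Finset ι) (s : ι → ℝ) (y : ι → Bool) (i : ι) : ℕ :=
  (S.filter (fun j => y j = true ∧ s i ≤ s j)).card

/-- Removing a positive instance `i` lowers the Mann–Whitney count by the number of negative
instances scored below `i`. -/
theorem mwCount_erase_add [DecidableEq ι] {S : Finset ι} (s : ι → ℝ) {y : ι → Bool} {i : ι}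
    (hi : i ∈ S) (hyi : y i = true) :
    mwCount (S.erase i) s y + (S.filter (fun j => y j = false ∧ s j < s i)).card
      = mwCount S s y := by
  have hcard : (S.filter (fun j => y j = false ∧ s j < s i)).card
      = ((S.filter (fun j => y j = false ∧ s j < s i)).image (fun j => (i, j))).card :=
    (card_image_of_injective _ (Prod.mk_right_injective i)).symm
  rw [hcard, mwCount, mwCount, ← card_union_of_disjoint]
  · congr 1
    ext ⟨a, b⟩
    simp only [mem_union, mem_filter, mem_product, mem_erase, mem_image, Prod.mk.injEq]
    constructor
    · rintro (h | ⟨j, h, rfl, rfl⟩) <;> tauto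
    · rintro ⟨⟨ha, hb⟩, hya, hyb, hlt⟩
      have hbi : b ≠ i := by rintro rfl; simp_all
      by_cases hai : a = i
      · subst hai
        exact Or.inr ⟨b, ⟨hb, hyb, hlt⟩, rfl, rfl⟩
      · exact Or.inl ⟨⟨⟨hai, ha⟩, hbi, hb⟩, hya, hyb, hlt⟩
  · rw [disjoint_left]
    rintro ⟨a, b⟩ h h'
    simp only [mem_filter, mem_product, mem_erase, mem_image, Prod.mk.injEq] at h h'
    obtain ⟨j, -, rfl, -⟩ := h'
    exact h.1.1.1 rfl

theorem card_posSet_erase_add_one [DecidableEq ι] {S : Finset ι} {y : ι → Bool} {i : ι}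
    (hi : i ∈ S) (hyi : y i = true) :
    (posSet (S.erase i) y).card + 1 = (posSet S y).card := by
  rw [posSet, posSet, filter_erase]
  exact card_erase_add_one (mem_filter.2 ⟨hi, hyi⟩)

theorem negSet_erase [DecidableEq ι] (S : Finset ι) {y : ι → Bool} {i : ι} (hyi : y i = true) :
    negSet (S.erase i) y = negSet S y := by
  rw [negSet, negSet, filter_erase]
  exact erase_eq_of_notMem (by simp [hyi])

theorem card_neg_below_lt_rank' {S : Finset ι} (s : ι → ℝ) {y : ι → Bool} {i : ι}
    (hi : i ∈ S) : (S.filter (fun j => y j = false ∧ s j < s i)).card < rank' S s i := by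
  refine card_lt_card ((ssubset_iff_of_subset ?_).2 ⟨i, by simp [hi], by simp⟩)
  intro j hj
  simp only [mem_filter] at hj ⊢
  exact ⟨hj.1, hj.2.2.le⟩

/-- Proposition 1 (single removal): if `i` is a positive instance with
`r'(i)/n ≤ AUC · p⁻`, removing `i` strictly increases the empirical AUC. -/
theorem prop1_single_removal [DecidableEq ι] (S : Finset ι) (s : ι → ℝ) (y : ι → Bool)
    (hs : Set.InjOn s S)
    (hpos : 2 ≤ (posSet S y).card) (hneg : 1 ≤ (negSet S y).card)
    (i : ι) (hi : i ∈ S) (hyi : y i = true)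
    (hcond : (rank' S s i : ℝ) / (S.card : ℝ) ≤
      auc S s y * (((negSet S y).card : ℝ) / (S.card : ℝ))) :
    auc S s y < auc (S.erase i) s y := by
  have hM := mwCount_erase_add s hi hyi
  have hP := card_posSet_erase_add_one hi hyi
  have hr := card_neg_below_lt_rank' s (y := y) hi
  have hn : (0 : ℝ) < S.card := by exact_mod_cast card_pos.2 ⟨i, hi⟩
  rw [auc, ← mul_div_assoc, div_le_div_iff_of_pos_right hn] at hcond
  rw [auc, auc, negSet_erase S hyi]
  set a := (S.filter (fun j => y j = false ∧ s j < s i)).card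
  set Q := (posSet (S.erase i) y).card
  have hN : (0 : ℝ) < (negSet S y).card := by exact_mod_cast hneg
  have hQ : (0 : ℝ) < Q := by
    have : 0 < Q := by omega
    exact_mod_cast this
  rw [← hP, ← hM] at hcond ⊢
  push_cast at hcond ⊢
  have hr' : (a : ℝ) < rank' S s i := by exact_mod_cast hr
  have hQ1 : (0 : ℝ) < Q + 1 := by positivity
  rw [div_mul_eq_mul_div, mul_div_mul_right _ _ hN.ne'] at hcond
  have key := hr'.trans_le hcond
  rw [lt_div_iff₀ hQ1] at key
  rw [← div_div, ← div_div, div_lt_div_iff_of_pos_right hN, div_lt_div_iff₀ hQ1 hQ]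
  linarith
end

section
/- Proposition 1 (set removal): Assume n⁺ ≥ 1 and n⁻ ≥ 1. Let P be a nonempty set of positive instances that is a proper subset of the positive instances, such that every i ∈ P satisfies r'(i)/n ≤ AUC · p⁻ (with r', n, AUC, p⁻ computed on the full sample). Then the empirical AUC of the reduced sample obtained by removing all instances in P is strictly greater than the empirical AUC of the full sample. -/
open Finset

variable {ι : Type*}

/-- The Mann–Whitney count, summed over the positive instances. -/
theorem mwCount_eq_sum (S : Finset ι) (s : ι → ℝ) (y : ι → Bool) :
    mwCount S s y = ∑ i ∈ posSet S y, #{j ∈ negSet S y | s j < s i} := by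
  simp only [mwCount, posSet, negSet, card_filter, sum_product, sum_filter]
  refine sum_congr rfl fun i _ => ?_
  by_cases hi : y i = true
  · simp only [hi, true_and, if_true]
    refine sum_congr rfl fun j _ => ?_
    by_cases hj : y j = false <;> simp [hj]
  · simp [hi]

/-- A positive instance outranks strictly fewer negative instances than its rank. -/
theorem card_negSet_filter_lt_rank' {S : Finset ι} {s : ι → ℝ} {y : ι → Bool} {i : ι}
    (hi : i ∈ posSet S y) : #{j ∈ negSet S y | s j < s i} < rank' S s i := by
  refine card_lt_card ⟨fun j hj => ?_, fun h => ?_⟩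
  · simp only [negSet, mem_filter] at hj ⊢
    exact ⟨hj.1.1, le_of_lt hj.2⟩
  · have := h (mem_filter.2 ⟨(mem_filter.1 hi).1, le_rfl⟩)
    exact lt_irrefl _ (mem_filter.1 this).2

theorem posSet_sdiff [DecidableEq ι] (S P : Finset ι) (y : ι → Bool) :
    posSet (S \ P) y = posSet S y \ P := by
  ext i
  simp only [posSet, mem_filter, mem_sdiff]
  tauto

theorem negSet_sdiff_of_subset_posSet [DecidableEq ι] {S P : Finset ι} {y : ι → Bool}
    (hP : P ⊆ posSet S y) : negSet (S \ P) y = negSet S y := by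
  ext i
  simp only [negSet, mem_filter, mem_sdiff]
  refine ⟨fun h => ⟨h.1.1, h.2⟩, fun h => ⟨⟨h.1, fun hi => ?_⟩, h.2⟩⟩
  simpa [h.2] using (mem_filter.1 (hP hi)).2

/-- Proposition 1 (set removal): removing a nonempty proper subset `P` of the positive
instances, all of whose elements satisfy `r'(i)/n ≤ AUC · p⁻` (on the full sample),
strictly increases the empirical AUC. -/
theorem prop1_set_removal [DecidableEq ι] (S : Finset ι) (s : ι → ℝ) (y : ι → Bool)
    (hs : Set.InjOn s S)
    (hpos : 1 ≤ (posSet S y).card) (hneg : 1 ≤ (negSet S y).card)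
    (P : Finset ι) (hPne : P.Nonempty) (hPsub : P ⊂ posSet S y)
    (hcond : ∀ i ∈ P, (rank' S s i : ℝ) / (S.card : ℝ) ≤
      auc S s y * (((negSet S y).card : ℝ) / (S.card : ℝ))) :
    auc S s y < auc (S \ P) s y := by
  have hN : (0 : ℝ) < #(negSet S y) := by exact_mod_cast hneg
  have hp : (0 : ℝ) < #(posSet S y) := by exact_mod_cast hpos
  have hS : (0 : ℝ) < #S := by
    exact_mod_cast hneg.trans (card_le_card (filter_subset _ S))
  have hremoved : (∑ i ∈ P, (#{j ∈ negSet S y | s j < s i} : ℝ)) <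
      #P * (auc S s y * #(negSet S y)) := by
    rw [← nsmul_eq_mul, ← sum_const]
    refine sum_lt_sum_of_nonempty hPne fun i hi => ?_
    have hrank := hcond i hi
    rw [← mul_div_assoc, div_le_div_iff_of_pos_right hS] at hrank
    refine lt_of_lt_of_le ?_ hrank
    exact_mod_cast card_negSet_filter_lt_rank' (hPsub.subset hi)
  have hsplit : (∑ i ∈ posSet S y \ P, (#{j ∈ negSet S y | s j < s i} : ℝ)) +
      ∑ i ∈ P, (#{j ∈ negSet S y | s j < s i} : ℝ) = mwCount S s y := by
    rw [sum_sdiff hPsub.subset, mwCount_eq_sum]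
    push_cast
    rfl
  have hauc : auc S s y * (#(posSet S y) * #(negSet S y)) = mwCount S s y :=
    div_mul_cancel₀ _ (mul_pos hp hN).ne'
  have hcard : (#(posSet S y \ P) : ℝ) + #P = #(posSet S y) := by
    exact_mod_cast card_sdiff_add_card_eq_card hPsub.subset
  have hkept : (0 : ℝ) < #(posSet S y \ P) := by
    exact_mod_cast card_pos.2 (sdiff_nonempty.2 hPsub.not_subset)
  rw [auc.eq_1 (S \ P), mwCount_eq_sum, posSet_sdiff, negSet_sdiff_of_subset_posSet hPsub.subset,
    lt_div_iff₀ (mul_pos hkept hN)]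
  push_cast
  rw [← hcard] at hauc
  linarith
end

section
/- Proposition 2 (single removal): Assume n⁺ ≥ 1 and n⁻ ≥ 2, and let i be a negative instance (y(i) = 0) such that t(i)/n⁺ ≤ AUC − 1/n⁺. Then the empirical AUC of the reduced sample obtained by removing i is strictly greater than the empirical AUC of the full sample. -/
open Finset

variable {ι : Type*}

/-- Removing a negative instance `i` loses at most `tcount S s y i` correctly ranked pairs. -/
theorem mwCount_le_mwCount_erase_add_tcount [DecidableEq ι] (S : Finset ι) (s : ι → ℝ)
    (y : ι → Bool) {i : ι} (hyi : y i = false) :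
    mwCount S s y ≤ mwCount (S.erase i) s y + tcount S s y i := by
  unfold mwCount tcount
  rw [← card_image_of_injective (S.filter fun j => y j = true ∧ s i ≤ s j)
    (Prod.mk_left_injective i)]
  refine (card_le_card ?_).trans (card_union_le _ _)
  rintro ⟨a, b⟩ h
  simp only [mem_filter, mem_product] at h
  obtain ⟨⟨ha, hb⟩, hya, hyb, hlt⟩ := h
  have hai : a ≠ i := by
    rintro rfl
    simp [hyi] at hya
  by_cases hbi : b = i
  · subst hbi
    exact mem_union_right _ (mem_image_of_mem _ (mem_filter.2 ⟨ha, hya, hlt.le⟩))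
  · exact mem_union_left _ (by simp [ha, hb, hya, hyb, hlt, hai, hbi])

theorem posSet_erase_of_neg [DecidableEq ι] (S : Finset ι) (y : ι → Bool) {i : ι}
    (hyi : y i = false) : posSet (S.erase i) y = posSet S y := by
  rw [posSet, filter_erase, erase_eq_of_notMem (by simp [hyi]), posSet]

theorem card_negSet_erase_add_one [DecidableEq ι] (S : Finset ι) (y : ι → Bool) {i : ι}
    (hi : i ∈ S) (hyi : y i = false) :
    (negSet (S.erase i) y).card + 1 = (negSet S y).card := by
  rw [negSet, filter_erase, negSet, card_erase_add_one (mem_filter.2 ⟨hi, hyi⟩)]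

/-- Proposition 2 (single removal): if `i` is a negative instance with
`t(i)/n⁺ ≤ AUC − 1/n⁺`, removing `i` strictly increases the empirical AUC. -/
theorem prop2_single_removal [DecidableEq ι] (S : Finset ι) (s : ι → ℝ) (y : ι → Bool)
    (hs : Set.InjOn s S)
    (hpos : 1 ≤ (posSet S y).card) (hneg : 2 ≤ (negSet S y).card)
    (i : ι) (hi : i ∈ S) (hyi : y i = false)
    (hcond : (tcount S s y i : ℝ) / ((posSet S y).card : ℝ) ≤
      auc S s y - 1 / ((posSet S y).card : ℝ)) :
    auc S s y < auc (S.erase i) s y := by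
  have hM : (mwCount S s y : ℝ) ≤ mwCount (S.erase i) s y + tcount S s y i := by
    exact_mod_cast mwCount_le_mwCount_erase_add_tcount S s y hyi
  have hN : ((negSet (S.erase i) y).card : ℝ) + 1 = (negSet S y).card := by
    exact_mod_cast card_negSet_erase_add_one S y hi hyi
  have hP : (0 : ℝ) < (posSet S y).card := by exact_mod_cast hpos
  have hN2 : (2 : ℝ) ≤ (negSet S y).card := by exact_mod_cast hneg
  have hN' : (0 : ℝ) < (negSet (S.erase i) y).card := by linarith
  have ht : (tcount S s y i : ℝ) / (posSet S y).card < auc S s y :=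
    hcond.trans_lt (sub_lt_self _ (by positivity))
  unfold auc at ht ⊢
  rw [posSet_erase_of_neg S y hyi, ← hN]
  rw [← hN, ← div_div, div_right_comm, div_lt_div_iff_of_pos_right hP,
    lt_div_iff₀ (by positivity)] at ht
  rw [← div_div, ← div_div, div_right_comm, div_right_comm (mwCount (S.erase i) s y : ℝ),
    div_lt_div_iff_of_pos_right hP, div_lt_div_iff₀ (by positivity) hN']
  nlinarith
end

section
/- Proposition 2 (set removal): Assume n⁺ ≥ 1 and n⁻ ≥ 1. Let Q be a nonempty set of negative instances that is a proper subset of the negative instances, such that every i ∈ Q satisfies t(i)/n⁺ ≤ AUC − 1/n⁺ (with t, n⁺, AUC computed on the full sample). Then the empirical AUC of the reduced sample obtained by removing all instances in Q is strictly greater than the empirical AUC of the full sample. -/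
open Finset

variable {ι : Type*}

/-- The Mann–Whitney count, summed over the negative instances. -/
theorem mwCount_eq_sum_negSet (S : Finset ι) (s : ι → ℝ) (y : ι → Bool) :
    mwCount S s y = ∑ j ∈ negSet S y, (S.filter (fun i => y i = true ∧ s j < s i)).card := by
  simp only [mwCount, negSet, card_filter, sum_product_right, sum_filter]
  refine sum_congr rfl fun j _ => ?_
  split_ifs with hj <;> simp [hj]

theorem posSet_sdiff_of_subset_negSet [DecidableEq ι] {S Q : Finset ι} {y : ι → Bool}
    (hQ : Q ⊆ negSet S y) : posSet (S \ Q) y = posSet S y := by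
  ext i
  have := @hQ i
  simp only [posSet, negSet, mem_filter, mem_sdiff] at this ⊢
  grind

theorem negSet_sdiff [DecidableEq ι] (S Q : Finset ι) (y : ι → Bool) :
    negSet (S \ Q) y = negSet S y \ Q := by
  ext i
  simp only [negSet, mem_filter, mem_sdiff]
  tauto

/-- Removing a set of negatives lowers the Mann–Whitney count by their contributions. -/
theorem mwCount_sdiff_add_sum [DecidableEq ι] {S Q : Finset ι} (s : ι → ℝ) {y : ι → Bool}
    (hQ : Q ⊆ negSet S y) :
    mwCount (S \ Q) s y + ∑ j ∈ Q, (S.filter (fun i => y i = true ∧ s j < s i)).card =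
      mwCount S s y := by
  rw [mwCount_eq_sum_negSet, mwCount_eq_sum_negSet, negSet_sdiff, ← sum_sdiff hQ]
  congr 1
  refine sum_congr rfl fun j _ => ?_
  rw [← filter_filter, ← filter_filter]
  exact congrArg (fun T => (T.filter (fun i => s j < s i)).card)
    (posSet_sdiff_of_subset_negSet hQ)

theorem card_filter_lt_le_tcount (S : Finset ι) (s : ι → ℝ) (y : ι → Bool) (j : ι) :
    (S.filter (fun i => y i = true ∧ s j < s i)).card ≤ tcount S s y j :=
  card_le_card (monotone_filter_right S fun _ _ h => ⟨h.1, h.2.le⟩)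

/-- Proposition 2 (set removal): removing a nonempty proper subset `Q` of the negative
instances, all of whose elements satisfy `t(i)/n⁺ ≤ AUC − 1/n⁺` (on the full sample),
strictly increases the empirical AUC. -/
theorem prop2_set_removal [DecidableEq ι] (S : Finset ι) (s : ι → ℝ) (y : ι → Bool)
    (hs : Set.InjOn s S)
    (hpos : 1 ≤ (posSet S y).card) (hneg : 1 ≤ (negSet S y).card)
    (Q : Finset ι) (hQne : Q.Nonempty) (hQsub : Q ⊂ negSet S y)
    (hcond : ∀ i ∈ Q, (tcount S s y i : ℝ) / ((posSet S y).card : ℝ) ≤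
      auc S s y - 1 / ((posSet S y).card : ℝ)) :
    auc S s y < auc (S \ Q) s y := by
  have hP : (0 : ℝ) < (posSet S y).card := by exact_mod_cast hpos
  have hN : (0 : ℝ) < (negSet S y).card := by exact_mod_cast hneg
  have hq : (0 : ℝ) < Q.card := by exact_mod_cast hQne.card_pos
  have hlt : (Q.card : ℝ) < (negSet S y).card := by exact_mod_cast card_lt_card hQsub
  have hcard : ((negSet (S \ Q) y).card : ℝ) = (negSet S y).card - Q.card := by
    rw [negSet_sdiff, cast_card_sdiff hQsub.1]
  have hcount : (mwCount (S \ Q) s y : ℝ) +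
      ∑ j ∈ Q, ((S.filter (fun i => y i = true ∧ s j < s i)).card : ℝ) = mwCount S s y := by
    exact_mod_cast mwCount_sdiff_add_sum s hQsub.1
  have hsum : ∑ j ∈ Q, ((S.filter (fun i => y i = true ∧ s j < s i)).card : ℝ) <
      Q.card * (mwCount S s y / (negSet S y).card) := by
    rw [← nsmul_eq_mul, ← sum_const]
    refine sum_lt_sum_of_nonempty hQne fun j hj => ?_
    have hle : ((S.filter (fun i => y i = true ∧ s j < s i)).card : ℝ) ≤ tcount S s y j := by
      exact_mod_cast card_filter_lt_le_tcount S s y j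
    have hauc : auc S s y = mwCount S s y / (negSet S y).card / (posSet S y).card := by
      rw [auc, div_div, mul_comm]
    have h := hcond j hj
    rw [hauc, ← sub_div, div_le_div_iff_of_pos_right hP] at h
    linarith
  rw [auc, auc, posSet_sdiff_of_subset_negSet hQsub.1, hcard,
    div_lt_div_iff₀ (by positivity) (mul_pos hP (sub_pos.2 hlt))]
  rw [← mul_div_assoc, lt_div_iff₀ hN] at hsum
  have hmul := mul_lt_mul_of_pos_left hsum hP
  rw [← eq_sub_iff_add_eq] at hcount
  rw [hcount]
  linarith
end

section
/- Exact characterization of beneficial negative abstention: Assume n⁺ ≥ 1 and n⁻ ≥ 2, and let i be a negative instance (y(i) = 0). Then the empirical AUC of the sample with i removed is strictly greater than the empirical AUC of the full sample if and only if t(i) < AUC · n⁺, and it is greater than or equal to the AUC of the full sample if and only if t(i) ≤ AUC · n⁺. -/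
open Finset

variable {ι : Type*}

/-- Removing a negative instance lowers the Mann–Whitney count by the number of positives
ranked above it. -/
theorem mwCount_erase_add_tcount [DecidableEq ι] (S : Finset ι) (s : ι → ℝ) (y : ι → Bool)
    (hs : Set.InjOn s S) {i : ι} (hi : i ∈ S) (hyi : y i = false) :
    mwCount (S.erase i) s y + tcount S s y i = mwCount S s y := by
  have ht : tcount S s y i =
      ((S.filter (fun j => y j = true ∧ s i ≤ s j)).image (fun j => (j, i))).card := by
    rw [card_image_of_injective _ (fun a b h => congrArg Prod.fst h), tcount]
  rw [ht, mwCount, mwCount, ← card_union_of_disjoint]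
  · congr 1
    ext ⟨a, b⟩
    simp only [mem_union, mem_filter, mem_product, mem_erase, mem_image, Prod.mk.injEq]
    constructor
    · rintro (h | ⟨j, ⟨hj, hyj, hle⟩, rfl, rfl⟩)
      · tauto
      · refine ⟨⟨hj, hi⟩, hyj, hyi, lt_of_le_of_ne hle fun he => ?_⟩
        have := hs hi hj he
        simp_all
    · rintro ⟨⟨ha, hb⟩, hya, hyb, hlt⟩
      by_cases hbi : b = i
      · subst hbi
        exact Or.inr ⟨a, ⟨ha, hya, hlt.le⟩, rfl, rfl⟩
      · have hai : a ≠ i := by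
          rintro rfl
          simp_all
        exact Or.inl ⟨⟨⟨hai, ha⟩, hbi, hb⟩, hya, hyb, hlt⟩
  · rw [disjoint_left]
    rintro ⟨a, b⟩ h₁ h₂
    simp only [mem_filter, mem_product, mem_erase, mem_image, Prod.mk.injEq] at h₁ h₂
    obtain ⟨j, -, -, rfl⟩ := h₂
    exact h₁.1.2.1 rfl

/-- Exact characterization of beneficial negative abstention: for a negative instance `i`,
removing `i` strictly increases the empirical AUC iff `t(i) < AUC · n⁺`, and does not
decrease it iff `t(i) ≤ AUC · n⁺`. -/
theorem exact_negative_abstention [DecidableEq ι] (S : Finset ι) (s : ι → ℝ) (y : ι → Bool)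
    (hs : Set.InjOn s S)
    (hpos : 1 ≤ (posSet S y).card) (hneg : 2 ≤ (negSet S y).card)
    (i : ι) (hi : i ∈ S) (hyi : y i = false) :
    (auc S s y < auc (S.erase i) s y ↔
      (tcount S s y i : ℝ) < auc S s y * ((posSet S y).card : ℝ)) ∧
    (auc S s y ≤ auc (S.erase i) s y ↔
      (tcount S s y i : ℝ) ≤ auc S s y * ((posSet S y).card : ℝ)) := by
  have hM : (mwCount (S.erase i) s y : ℝ) + tcount S s y i = mwCount S s y := by
    exact_mod_cast mwCount_erase_add_tcount S s y hs hi hyi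
  have hm : ((negSet (S.erase i) y).card : ℝ) + 1 = (negSet S y).card := by
    exact_mod_cast card_negSet_erase_add_one S y hi hyi
  have hp : (0 : ℝ) < (posSet S y).card := by exact_mod_cast hpos
  have hq : (0 : ℝ) < (negSet (S.erase i) y).card := by
    have : (2 : ℝ) ≤ (negSet S y).card := by exact_mod_cast hneg
    linarith
  rw [auc, auc, posSet_erase_of_neg S y hyi, ← hM, ← hm]
  generalize (mwCount (S.erase i) s y : ℝ) = M
  generalize (tcount S s y i : ℝ) = t
  generalize ((posSet S y).card : ℝ) = p at *
  generalize ((negSet (S.erase i) y).card : ℝ) = q at *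
  have hq1 : 0 < q + 1 := by linarith
  have hAUC : (M + t) / (p * (q + 1)) * p = (M + t) / (q + 1) := by field_simp
  rw [hAUC, div_lt_div_iff₀ (by positivity) (by positivity), lt_div_iff₀ hq1,
    div_le_div_iff₀ (by positivity) (by positivity), le_div_iff₀ hq1]
  have h : M * (p * (q + 1)) - (M + t) * (p * q) = p * (M + t - t * (q + 1)) := by ring
  constructor
  · rw [← sub_pos, h, mul_pos_iff_of_pos_left hp, sub_pos]
  · rw [← sub_nonneg, h, mul_nonneg_iff_of_pos_left hp, sub_nonneg]
end

section
/- CAP area change when removing a positive instance (equation (8) in absolute units): Assume n ≥ 2, n⁺ ≥ 1, and let i be a positive instance (y(i) = 1). Let Area be the absolute area under the CAP polyline of the full sample and Area' the absolute area under the CAP polyline of the sample with i removed (recomputed on the n − 1 remaining instances). Then Area' = Area − (r'(i) − 1) − (t(i) − 1) − 1/2. -/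
open Finset

variable {ι : Type*}

/-- `T(r)`: the number of positive instances among the `r` highest-scoring instances
(scores are pairwise distinct, so this is the number of positives `j` whose
rank-from-the-top `#{k ∈ S : s k ≥ s j}` is at most `r`). -/
noncomputable def capT (S : Finset ι) (s : ι → ℝ) (y : ι → Bool) (r : ℕ) : ℕ :=
  (S.filter (fun j => y j = true ∧ (S.filter (fun k => s j ≤ s k)).card ≤ r)).card

/-- The absolute area under the CAP polyline: `Σ_{r=1}^{n} (T(r−1) + T(r))/2`. -/
noncomputable def capArea (S : Finset ι) (s : ι → ℝ) (y : ι → Bool) : ℝ :=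
  ∑ r ∈ Finset.range S.card, ((capT S s y r : ℝ) + (capT S s y (r + 1) : ℝ)) / 2

/-- The CAP area as a sum over the positive instances: each one contributes the number of
instances scoring strictly below it, plus one half. -/
theorem capArea_eq_sum (S : Finset ι) (s : ι → ℝ) (y : ι → Bool) :
    capArea S s y = ∑ j ∈ posSet S y, (((S.filter (fun k => s k < s j)).card : ℝ) + 1 / 2) := by
  have hT : ∀ r, (capT S s y r : ℝ) =
      ∑ j ∈ posSet S y, if (S.filter (fun k => s j ≤ s k)).card ≤ r then (1 : ℝ) else 0 := by
    intro r
    rw [Finset.sum_boole, capT, posSet, Finset.filter_filter]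
  simp only [capArea, hT, ← Finset.sum_add_distrib, Finset.sum_div]
  rw [Finset.sum_comm]
  refine Finset.sum_congr rfl fun j hj => ?_
  have hjS : j ∈ S := (Finset.mem_filter.mp hj).1
  have hsplit := Finset.card_filter_add_card_filter_not (s := S) (fun k => s j ≤ s k)
  simp only [not_le] at hsplit
  have hd : 1 ≤ (S.filter (fun k => s j ≤ s k)).card :=
    Finset.card_pos.mpr ⟨j, Finset.mem_filter.mpr ⟨hjS, le_rfl⟩⟩
  generalize (S.filter (fun k => s j ≤ s k)).card = d at *
  generalize (S.filter (fun k => s k < s j)).card = b at *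
  have h1 : (Finset.range S.card).filter (fun r => d ≤ r) = Finset.Ico d S.card := by
    ext r; simp only [Finset.mem_filter, Finset.mem_range, Finset.mem_Ico]; omega
  have h2 : (Finset.range S.card).filter (fun r => d ≤ r + 1) = Finset.Ico (d - 1) S.card := by
    ext r; simp only [Finset.mem_filter, Finset.mem_range, Finset.mem_Ico]; omega
  rw [← Finset.sum_div, Finset.sum_add_distrib, Finset.sum_boole, Finset.sum_boole, h1, h2,
    Nat.card_Ico, Nat.card_Ico, show S.card - d = b by omega,
    show S.card - (d - 1) = b + 1 by omega]
  push_cast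
  ring

theorem rank'_eq_card_lt_add_one {S : Finset ι} {s : ι → ℝ} (hs : Set.InjOn s S) {i : ι}
    (hi : i ∈ S) : rank' S s i = (S.filter (fun k => s k < s i)).card + 1 := by
  classical
  rw [rank', ← Finset.card_insert_of_notMem (a := i) (by simp)]
  congr 1
  ext k
  simp only [Finset.mem_filter, Finset.mem_insert, le_iff_lt_or_eq]
  grind [Set.InjOn]

theorem tcount_eq_card_lt_add_one {S : Finset ι} {s : ι → ℝ} {y : ι → Bool}
    (hs : Set.InjOn s S) {i : ι} (hi : i ∈ S) (hyi : y i = true) :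
    tcount S s y i = ((posSet S y).filter (fun j => s i < s j)).card + 1 := by
  classical
  rw [tcount, ← Finset.card_insert_of_notMem (a := i) (by simp)]
  congr 1
  ext k
  simp only [posSet, Finset.mem_filter, Finset.mem_insert, le_iff_lt_or_eq]
  grind [Set.InjOn]

/-- Erasing `i` lowers the count of instances below `j` by one exactly when `i` is below `j`. -/
theorem card_filter_lt_erase [DecidableEq ι] {S : Finset ι} (s : ι → ℝ) {i : ι} (hi : i ∈ S)
    (j : ι) : (((S.erase i).filter (fun k => s k < s j)).card : ℝ) =
      ((S.filter (fun k => s k < s j)).card : ℝ) - if s i < s j then 1 else 0 := by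
  simp only [← Finset.sum_boole]
  rw [← Finset.add_sum_erase S _ hi]
  ring

/-- CAP area change when removing a positive instance `i`:
`Area' = Area − (r'(i) − 1) − (t(i) − 1) − 1/2`. -/
theorem cap_area_remove_positive [DecidableEq ι]
    (S : Finset ι) (s : ι → ℝ) (y : ι → Bool)
    (hs : Set.InjOn s S)
    (hn : 2 ≤ S.card) (hpos : 1 ≤ (posSet S y).card)
    (i : ι) (hi : i ∈ S) (hyi : y i = true) :
    capArea (S.erase i) s y =
      capArea S s y - ((rank' S s i : ℝ) - 1) - ((tcount S s y i : ℝ) - 1) - 1 / 2 := by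
  have hP : posSet (S.erase i) y = (posSet S y).erase i := Finset.filter_erase _ _ _
  have hiP : i ∈ posSet S y := Finset.mem_filter.mpr ⟨hi, hyi⟩
  have hU : ∑ j ∈ (posSet S y).erase i, (if s i < s j then (1 : ℝ) else 0) =
      (((posSet S y).filter (fun j => s i < s j)).card : ℝ) := by
    rw [← Finset.sum_boole, ← Finset.add_sum_erase _ _ hiP]
    simp
  rw [capArea_eq_sum, capArea_eq_sum, hP, ← Finset.add_sum_erase _ _ hiP,
    rank'_eq_card_lt_add_one hs hi, tcount_eq_card_lt_add_one hs hi hyi]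
  simp only [card_filter_lt_erase s hi, sub_add_eq_add_sub, Finset.sum_sub_distrib, hU]
  push_cast
  ring
end

section
/- CAP area change when removing a negative instance: Assume n ≥ 2, and let i be a negative instance (y(i) = 0). Let Area be the absolute area under the CAP polyline of the full sample and Area' the absolute area under the CAP polyline of the sample with i removed (recomputed on the n − 1 remaining instances). Then Area' = Area − t(i), where t(i) is the number of positive instances with score above s(i). -/
open Finset

variable {ι : Type*}

/-- The number of `r < n` with `d ≤ r`, as a sum of indicators. -/
lemma sum_range_ite_le {d n : ℕ} (h : d ≤ n) :
    ∑ r ∈ Finset.range n, (if d ≤ r then (1 : ℝ) else 0) = n - d := by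
  induction n, h using Nat.le_induction with
  | base =>
    rw [sub_self]
    exact Finset.sum_eq_zero fun r hr => if_neg (by simpa using hr)
  | succ m hm ih =>
    rw [Finset.sum_range_succ, ih, if_pos hm]
    push_cast
    ring

/-- The area under the CAP polyline as a sum over the positive instances, each contributing
according to its rank from the top. -/
lemma capArea_eq_sum_posSet (S : Finset ι) (s : ι → ℝ) (y : ι → Bool) :
    capArea S s y =
      ∑ j ∈ posSet S y, ((S.card : ℝ) + 1 / 2 - ((S.filter (fun k => s j ≤ s k)).card : ℝ)) := by
  have hT (r : ℕ) : (capT S s y r : ℝ) =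
      ∑ j ∈ posSet S y, if (S.filter (fun k => s j ≤ s k)).card ≤ r then (1 : ℝ) else 0 := by
    rw [capT, posSet, ← Finset.filter_filter, Finset.sum_boole]
  simp only [capArea, hT, ← Finset.sum_add_distrib, Finset.sum_div]
  rw [Finset.sum_comm]
  refine Finset.sum_congr rfl fun j hj => ?_
  have hjS : j ∈ S := (Finset.mem_filter.1 hj).1
  have hpos : 0 < (S.filter (fun k => s j ≤ s k)).card :=
    Finset.card_pos.2 ⟨j, Finset.mem_filter.2 ⟨hjS, le_rfl⟩⟩
  have hle : (S.filter (fun k => s j ≤ s k)).card ≤ S.card := Finset.card_filter_le _ _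
  generalize (S.filter (fun k => s j ≤ s k)).card = d at hpos hle
  obtain ⟨e, rfl⟩ := Nat.exists_eq_succ_of_ne_zero hpos.ne'
  rw [← Finset.sum_div, Finset.sum_add_distrib, sum_range_ite_le hle]
  simp only [Nat.succ_eq_add_one, Nat.add_le_add_iff_right]
  rw [sum_range_ite_le (Nat.le_of_succ_le hle)]
  push_cast
  ring

/-- CAP area change when removing a negative instance `i`: `Area' = Area − t(i)`,
where `t(i)` is the number of positive instances with score above `s i`. -/
theorem cap_area_remove_negative [DecidableEq ι]
    (S : Finset ι) (s : ι → ℝ) (y : ι → Bool)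
    (hs : Set.InjOn s S)
    (hn : 2 ≤ S.card)
    (i : ι) (hi : i ∈ S) (hyi : y i = false) :
    capArea (S.erase i) s y = capArea S s y - (tcount S s y i : ℝ) := by
  have hpos : posSet (S.erase i) y = posSet S y := by
    rw [posSet, posSet, Finset.filter_erase, Finset.erase_eq_of_notMem]
    simp [hyi]
  have ht : (tcount S s y i : ℝ) = ∑ j ∈ posSet S y, if s i ≤ s j then (1 : ℝ) else 0 := by
    rw [tcount, posSet, ← Finset.filter_filter, Finset.sum_boole]
  rw [capArea_eq_sum_posSet, capArea_eq_sum_posSet, hpos, ht, ← Finset.sum_sub_distrib]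
  refine Finset.sum_congr rfl fun j hj => ?_
  obtain ⟨hjS, hyj⟩ := Finset.mem_filter.1 hj
  have hne : s j ≠ s i := fun h => by
    rw [hs hjS hi h, hyi] at hyj
    exact Bool.false_ne_true hyj
  rw [Finset.filter_erase, Finset.cast_card_erase_of_mem hi]
  rcases hne.lt_or_gt with h | h
  · rw [Finset.cast_card_erase_of_mem (Finset.mem_filter.2 ⟨hi, h.le⟩), if_neg h.not_ge]
    ring
  · rw [Finset.erase_eq_of_notMem (by simp [h]), if_pos h.le]
    ring
end
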